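/- arXiv:2112.14965 — 3 statements merged into one kernel-verified Lean document; each statement's English description precedes it below -/
import Mathlib

section
/- If P =_BCI Q and x occurs (exactly once) free in both P and Q, then λ*x.P =_BCI λ*x.Q. -/
/-!
The linear combinatory logic `BCI` and the linear lambda calculus, with
the translations `(-)♯ : BCI → λ_lin` and `(-)♭ : λ_lin → BCI`
(Appendix A of Hasegawa, "The braided lambda calculus").
-/

namespace BCILin

/-- `BCI`-terms: variables, the constants `B`, `C`, `I`, and application. -/
inductive CT : Type
  | var : ℕ → CT
  | B : CT
  | C : CT
  | I : CT
  | app : CT → CT → CT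

infixl:70 " ⬝ " => CT.app

/-- The list of (free) variables of a `BCI`-term. -/
def cfv : CT → List ℕ
  | .var x => [x]
  | .app P Q => cfv P ++ cfv Q
  | _ => []

/-- A `BCI`-term is linear: every variable occurs at most once. -/
def CWF (P : CT) : Prop := (cfv P).Nodup

/-- `=_BCI`: the smallest congruence on `BCI`-terms satisfying the ten
axioms of Figure 6 (a complete axiomatization of `BCI`). -/
inductive CEq : CT → CT → Prop
  | refl (P : CT) : CEq P P
  | symm {P Q : CT} : CEq P Q → CEq Q P
  | trans {P Q R : CT} : CEq P Q → CEq Q R → CEq P R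
  | app {P P' Q Q' : CT} : CEq P P' → CEq Q Q' → CEq (P ⬝ Q) (P' ⬝ Q')
  | axB (L M N : CT) : CEq (.B ⬝ L ⬝ M ⬝ N) (L ⬝ (M ⬝ N))
  | axC (L M N : CT) : CEq (.C ⬝ L ⬝ M ⬝ N) (L ⬝ N ⬝ M)
  | axI (M : CT) : CEq (.I ⬝ M) M
  | axBI : CEq (.B ⬝ .I) .I
  | axCBI : CEq (.C ⬝ .B ⬝ .I) .I
  | ax6 : CEq (.B ⬝ (.B ⬝ .B) ⬝ .B) (.B ⬝ (.C ⬝ .B ⬝ .B) ⬝ (.B ⬝ .B ⬝ .B))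
  | ax7 : CEq (.B ⬝ (.B ⬝ .C) ⬝ (.B ⬝ .B ⬝ .B)) (.B ⬝ (.C ⬝ .B ⬝ .C) ⬝ (.B ⬝ .B ⬝ .B))
  | ax8 : CEq (.B ⬝ (.B ⬝ .B) ⬝ .C) (.B ⬝ .C ⬝ (.B ⬝ (.B ⬝ .C) ⬝ .B))
  | axR2 : CEq (.B ⬝ .C ⬝ .C) .I
  | axR3 : CEq (.B ⬝ (.B ⬝ .C) ⬝ (.B ⬝ .C ⬝ (.B ⬝ .C))) (.B ⬝ .C ⬝ (.B ⬝ (.B ⬝ .C) ⬝ .C))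

/-- Lambda terms (for the linear lambda calculus `λ_lin`). -/
inductive LT : Type
  | var : ℕ → LT
  | lam : ℕ → LT → LT
  | app : LT → LT → LT

/-- The list of free variables of a lambda term. -/
def lfv : LT → List ℕ
  | .var x => [x]
  | .lam x M => (lfv M).erase x
  | .app M N => lfv M ++ lfv N

/-- `M` is a linear lambda term: every variable occurs exactly once. -/
def LWF : LT → Prop
  | .var _ => True
  | .lam x M => LWF M ∧ (lfv M).count x = 1
  | .app M N => LWF M ∧ LWF N ∧ ∀ x ∈ lfv M, x ∉ lfv N

/-- Substitution `M[x := N]` of lambda terms. -/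
def lsubst : LT → ℕ → LT → LT
  | .var y, x, N => if y = x then N else .var y
  | .lam y M, x, N => if y = x then .lam y M else .lam y (lsubst M x N)
  | .app M₁ M₂, x, N => .app (lsubst M₁ x N) (lsubst M₂ x N)

/-- `=βη` on lambda terms: the smallest congruence containing β and η. -/
inductive LEq : LT → LT → Prop
  | refl (M : LT) : LEq M M
  | symm {M N : LT} : LEq M N → LEq N M
  | trans {M N P : LT} : LEq M N → LEq N P → LEq M P
  | lam (x : ℕ) {M M' : LT} : LEq M M' → LEq (.lam x M) (.lam x M')
  | app {M M' N N' : LT} : LEq M M' → LEq N N' → LEq (.app M N) (.app M' N')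
  | beta (x : ℕ) (M N : LT) : LEq (.app (.lam x M) N) (lsubst M x N)
  | eta (x : ℕ) (M : LT) (h : x ∉ lfv M) : LEq (.lam x (.app M (.var x))) M

/-- `=β` on lambda terms: the smallest congruence containing β. -/
inductive LEqBeta : LT → LT → Prop
  | refl (M : LT) : LEqBeta M M
  | symm {M N : LT} : LEqBeta M N → LEqBeta N M
  | trans {M N P : LT} : LEqBeta M N → LEqBeta N P → LEqBeta M P
  | lam (x : ℕ) {M M' : LT} : LEqBeta M M' → LEqBeta (.lam x M) (.lam x M')
  | app {M M' N N' : LT} : LEqBeta M M' → LEqBeta N N' → LEqBeta (.app M N) (.app M' N')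
  | beta (x : ℕ) (M N : LT) : LEqBeta (.app (.lam x M) N) (lsubst M x N)

/-- The translation `(-)♯ : BCI → λ_lin`:
`B♯ = λxyz.x (y z)`, `C♯ = λxyz.x z y`, `I♯ = λx.x`, homomorphic on
variables and application. -/
def sharp : CT → LT
  | .var x => .var x
  | .B => .lam 1 (.lam 2 (.lam 3 (.app (.var 1) (.app (.var 2) (.var 3)))))
  | .C => .lam 1 (.lam 2 (.lam 3 (.app (.app (.var 1) (.var 3)) (.var 2))))
  | .I => .lam 1 (.var 1)
  | .app P Q => .app (sharp P) (sharp Q)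

/-- Bracket abstraction `λ*x.P` (for `x` occurring exactly once in `P`):
`λ*x.x = I`; `λ*x.(P Q) = C (λ*x.P) Q` if `x` is free in `P`, and
`λ*x.(P Q) = B P (λ*x.Q)` otherwise. -/
def lstar (x : ℕ) : CT → CT
  | .var y => if y = x then .I else .var y
  | .app P Q => if x ∈ cfv P then .C ⬝ lstar x P ⬝ Q else .B ⬝ P ⬝ lstar x Q
  | P => P

/-- The translation `(-)♭ : λ_lin → BCI`:
`x♭ = x`, `(M N)♭ = M♭ N♭`, `(λx.M)♭ = λ*x.M♭`. -/
def flat : LT → CT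
  | .var x => .var x
  | .app M N => .app (flat M) (flat N)
  | .lam x M => lstar x (flat M)

end BCILin

namespace BCILin

/-- `=_BCI` as a setoid on `BCI`-terms. -/
def ceqSetoid : Setoid CT := ⟨CEq, CEq.refl, CEq.symm, CEq.trans⟩

/-- The applicative structure of `BCI`-terms modulo `=_BCI`. -/
abbrev CQuot : Type := Quotient ceqSetoid

namespace CQuot

/-- The class of a term modulo `=_BCI`. -/
def mk (P : CT) : CQuot := Quotient.mk ceqSetoid P

theorem mk_eq_mk {P Q : CT} : mk P = mk Q ↔ CEq P Q := Quotient.eq (r := ceqSetoid)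

/-- Application of classes. -/
instance : Mul CQuot :=
  ⟨Quotient.map₂ CT.app fun _ _ h _ _ h' => CEq.app h h'⟩

theorem mk_app (P Q : CT) : mk (P ⬝ Q) = mk P * mk Q := rfl

/-- The class of `B`. -/
def B : CQuot := mk .B

/-- The class of `C`. -/
def C : CQuot := mk .C

/-- The class of `I`. -/
def I : CQuot := mk .I

theorem mk_B : mk .B = B := rfl

theorem mk_C : mk .C = C := rfl

theorem B_app (l m n : CQuot) : B * l * m * n = l * (m * n) := by
  induction l, m using Quotient.inductionOn₂
  induction n using Quotient.inductionOn
  exact mk_eq_mk.2 (.axB _ _ _)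

theorem C_app (l m n : CQuot) : C * l * m * n = l * n * m := by
  induction l, m using Quotient.inductionOn₂
  induction n using Quotient.inductionOn
  exact mk_eq_mk.2 (.axC _ _ _)

theorem I_app (m : CQuot) : I * m = m := by
  induction m using Quotient.inductionOn
  exact mk_eq_mk.2 (.axI _)

theorem C_C (l : CQuot) : C * (C * l) = l := by
  have h : B * C * C = I := mk_eq_mk.2 .axR2
  simpa only [B_app, I_app] using congrArg (· * l) h

theorem B_B_app (l m n : CQuot) : B * (B * l * m) * n = B * l * (B * m * n) := by
  have h : B * (B * B) * B = B * (C * B * B) * (B * B * B) := mk_eq_mk.2 .ax6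
  simpa only [B_app, C_app] using congrArg (· * l * m * n) h

theorem C_B_B_app (l m n : CQuot) : C * (B * (B * l) * m) * n = B * l * (C * m * n) := by
  have h : B * (B * C) * (B * B * B) = B * (C * B * C) * (B * B * B) := mk_eq_mk.2 .ax7
  simpa only [B_app, C_app] using congrArg (· * l * m * n) h

theorem B_B_C (l : CQuot) : B * B * (C * l) = C * (B * C * (B * l)) := by
  have h : B * (B * B) * C = B * C * (B * (B * C) * B) := mk_eq_mk.2 .ax8
  simpa only [B_app] using congrArg (· * l) h

theorem B_C_app (l m n : CQuot) : B * (C * l * m) * n = C * (B * l * n) * m := by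
  simpa only [B_app, C_app] using congrArg (· * m * n) (B_B_C l)

theorem C_C_B_C (l m n : CQuot) : C * (C * (B * C * l) * m) * n = C * (C * l * n) * m := by
  have h : B * (B * C) * (B * C * (B * C)) = B * C * (B * (B * C) * C) := mk_eq_mk.2 .axR3
  simpa only [B_app, C_app] using congrArg (· * l * m * n) h

theorem C_B_C_app (l m n : CQuot) : C * (B * (C * l) * m) * n = B * (l * n) * m := by
  rw [← B_C_app, C_C]

theorem C_C_B_B (l m n : CQuot) : C * (C * (B * B * l) * m) * n = C * l * (m * n) := by
  calc C * (C * (B * B * l) * m) * n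
      = C * (C * (B * B * (C * (C * l))) * m) * n := by rw [C_C]
    _ = B * (C * l) * m * n := by rw [B_B_C, C_C, B_app, C_C]
    _ = C * l * (m * n) := B_app _ _ _

end CQuot

theorem CEq.cfv_perm {P Q : CT} (h : CEq P Q) : (cfv P).Perm (cfv Q) := by
  induction h with
  | symm _ ih => exact ih.symm
  | trans _ _ ih ih' => exact ih.trans ih'
  | app _ _ ih ih' => exact ih.append ih'
  | axC L M N =>
    simp only [cfv, List.nil_append, List.append_assoc]
    exact List.perm_append_comm.append_left _
  | _ => simp [cfv]

theorem lstar_app_left {x : ℕ} {P : CT} (Q : CT) (h : x ∈ cfv P) :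
    lstar x (P ⬝ Q) = .C ⬝ lstar x P ⬝ Q := if_pos h

theorem lstar_app_right {x : ℕ} {P : CT} (Q : CT) (h : x ∉ cfv P) :
    lstar x (P ⬝ Q) = .B ⬝ P ⬝ lstar x Q := if_neg h

open CQuot in
theorem mk_lstar_axB (x : ℕ) (L M N : CT) :
    mk (lstar x (.B ⬝ L ⬝ M ⬝ N)) = mk (lstar x (L ⬝ (M ⬝ N))) := by
  by_cases hL : x ∈ cfv L
  · simpa [lstar, cfv, hL, mk_app, mk_B, mk_C] using C_C_B_B _ _ _
  by_cases hM : x ∈ cfv M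
  · simpa [lstar, cfv, hL, hM, mk_app, mk_B, mk_C] using C_B_B_app _ _ _
  · simpa [lstar, cfv, hL, hM, mk_app, mk_B, mk_C] using B_B_app _ _ _

open CQuot in
theorem mk_lstar_axC {x : ℕ} (L M N : CT) (h : (cfv (L ⬝ N ⬝ M)).count x = 1) :
    mk (lstar x (.C ⬝ L ⬝ M ⬝ N)) = mk (lstar x (L ⬝ N ⬝ M)) := by
  by_cases hL : x ∈ cfv L
  · simpa [lstar, cfv, hL, mk_app, mk_B, mk_C] using C_C_B_C _ _ _
  by_cases hM : x ∈ cfv M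
  · have hN : x ∉ cfv N := by
      have := List.count_pos_iff.2 hM
      simp only [cfv, List.count_append] at h
      exact List.count_eq_zero.1 (by omega)
    simpa [lstar, cfv, hL, hM, hN, mk_app, mk_B, mk_C] using C_B_C_app _ _ _
  · have hN : x ∈ cfv N := by
      simp only [cfv, List.count_append, List.count_eq_zero.2 hL, List.count_eq_zero.2 hM] at h
      exact List.count_pos_iff.1 (by omega)
    simpa [lstar, cfv, hL, hM, hN, mk_app, mk_B, mk_C] using B_C_app _ _ _

end BCILin

open BCILin in
/-- If `P =_BCI Q` and the variable `x` occurs exactly once (free) in both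
`P` and `Q`, then `λ*x.P =_BCI λ*x.Q`. -/
theorem lstar_congruence (P Q : CT) (x : ℕ) (h : CEq P Q)
    (hP : (cfv P).count x = 1) (hQ : (cfv Q).count x = 1) :
    CEq (lstar x P) (lstar x Q) := by
  induction h with
  | refl P => exact .refl _
  | symm _ ih => exact (ih hQ hP).symm
  | trans h _ ih ih' =>
    have hR := (h.cfv_perm.count_eq x).symm.trans hP
    exact (ih hP hR).trans (ih' hR hQ)
  | @app P P' Q Q' h h' ih ih' =>
    simp only [cfv, List.count_append] at hP
    have hc := h.cfv_perm.count_eq x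
    have hc' := h'.cfv_perm.count_eq x
    by_cases hx : x ∈ cfv P
    · have := List.count_pos_iff.2 hx
      rw [lstar_app_left _ hx, lstar_app_left _ (h.cfv_perm.mem_iff.1 hx)]
      exact .app (.app (.refl _) (ih (by omega) (by omega))) h'
    · have := List.count_eq_zero.2 hx
      rw [lstar_app_right _ hx, lstar_app_right _ (mt h.cfv_perm.mem_iff.2 hx)]
      exact .app (.app (.refl _) h) (ih' (by omega) (by omega))
  | axB L M N => exact CQuot.mk_eq_mk.1 (mk_lstar_axB x L M N)
  | axC L M N => exact CQuot.mk_eq_mk.1 (mk_lstar_axC L M N hQ)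
  | axI M => exact .trans (.app .axBI (.refl _)) (.axI _)
  | _ => simp [cfv] at hP
end

section
/- Let G be a group and let X, Y, Z be crossed G-sets. Define σ_{X,Y} : X × Y → Y × X by σ_{X,Y}(x,y) = (|x| • y, x). Then: (i) σ_{X,Y} is a bijection, with inverse (b,a) ↦ (a, |a|⁻¹ • b); (ii) σ_{X,Y} is G-equivariant (σ(g•x, g•y) = (g•(|x|•y), g•x)) and valuation-preserving (||x|•y| · |x| = |x| · |y|); (iii) the Yang–Baxter equation holds: as maps X × Y × Z → Z × Y × X, (σ_{Y,Z} × id_X) ∘ (id_Y × σ_{X,Z}) ∘ (σ_{X,Y} × id_Z) = (id_Z × σ_{X,Y}) ∘ (σ_{X,Z} × id_Y) ∘ (id_X × σ_{Y,Z}). -/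
/-- A crossed `G`-set: a set with a `G`-action `act` and a valuation
`val : X → G` satisfying `|g • x| = g |x| g⁻¹`. -/
structure XGSet (G : Type*) [Group G] where
  carrier : Type*
  act : G → carrier → carrier
  one_act : ∀ x, act 1 x = x
  mul_act : ∀ g h x, act (g * h) x = act g (act h x)
  val : carrier → G
  val_act : ∀ g x, val (act g x) = g * val x * g⁻¹

/-- The braiding `σ_{X,Y}(x, y) = (|x| • y, x)` of crossed `G`-sets. -/
def XGSet.sigma {G : Type*} [Group G] (X Y : XGSet G) :
    X.carrier × Y.carrier → Y.carrier × X.carrier :=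
  fun p => (Y.act (X.val p.1) p.2, p.1)

/-- The map `(b, a) ↦ (a, |a|⁻¹ • b)`, inverse to `σ_{X,Y}`. -/
def XGSet.sigmaInv {G : Type*} [Group G] (X Y : XGSet G) :
    Y.carrier × X.carrier → X.carrier × Y.carrier :=
  fun q => (q.2, Y.act (X.val q.2)⁻¹ q.1)

/-- The left-hand side of the Yang–Baxter equation,
`(σ_{Y,Z} × id_X) ∘ (id_Y × σ_{X,Z}) ∘ (σ_{X,Y} × id_Z)`. -/
def XGSet.ybLHS {G : Type*} [Group G] (X Y Z : XGSet G) :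
    X.carrier × Y.carrier × Z.carrier → Z.carrier × Y.carrier × X.carrier :=
  fun p =>
    let q₁ := X.sigma Y (p.1, p.2.1)
    let p₁ : Y.carrier × X.carrier × Z.carrier := (q₁.1, q₁.2, p.2.2)
    let q₂ := X.sigma Z (p₁.2.1, p₁.2.2)
    let p₂ : Y.carrier × Z.carrier × X.carrier := (p₁.1, q₂.1, q₂.2)
    let q₃ := Y.sigma Z (p₂.1, p₂.2.1)
    (q₃.1, q₃.2, p₂.2.2)

/-- The right-hand side of the Yang–Baxter equation,
`(id_Z × σ_{X,Y}) ∘ (σ_{X,Z} × id_Y) ∘ (id_X × σ_{Y,Z})`. -/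
def XGSet.ybRHS {G : Type*} [Group G] (X Y Z : XGSet G) :
    X.carrier × Y.carrier × Z.carrier → Z.carrier × Y.carrier × X.carrier :=
  fun p =>
    let q₁ := Y.sigma Z (p.2.1, p.2.2)
    let p₁ : X.carrier × Z.carrier × Y.carrier := (p.1, q₁.1, q₁.2)
    let q₂ := X.sigma Z (p₁.1, p₁.2.1)
    let p₂ : Z.carrier × X.carrier × Y.carrier := (q₂.1, q₂.2, p₁.2.2)
    let q₃ := X.sigma Y (p₂.2.1, p₂.2.2)
    (p₂.1, q₃.1, q₃.2)

/-- Let `G` be a group and `X`, `Y`, `Z` crossed `G`-sets, and let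
`σ_{X,Y}(x,y) = (|x| • y, x)`.  Then (i) `σ_{X,Y}` is a bijection with
inverse `(b, a) ↦ (a, |a|⁻¹ • b)`; (ii) `σ_{X,Y}` is `G`-equivariant and
valuation-preserving (`||x| • y| ⬝ |x| = |x| ⬝ |y|`); (iii) the
Yang–Baxter equation holds. -/
theorem XGSet.braiding {G : Type*} [Group G] (X Y Z : XGSet G) :
    -- (i) bijectivity, with the stated inverse
    (Function.Bijective (X.sigma Y) ∧
      Function.LeftInverse (X.sigmaInv Y) (X.sigma Y) ∧
      Function.RightInverse (X.sigmaInv Y) (X.sigma Y)) ∧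
    -- (ii) equivariance and valuation-preservation
    ((∀ (g : G) (x : X.carrier) (y : Y.carrier),
        X.sigma Y (X.act g x, Y.act g y) = (Y.act g (Y.act (X.val x) y), X.act g x)) ∧
      (∀ (x : X.carrier) (y : Y.carrier),
        Y.val (Y.act (X.val x) y) * X.val x = X.val x * Y.val y)) ∧
    -- (iii) Yang–Baxter
    X.ybLHS Y Z = X.ybRHS Y Z := by
  have hl : Function.LeftInverse (X.sigmaInv Y) (X.sigma Y) := fun p => by
    simp [XGSet.sigma, XGSet.sigmaInv, ← Y.mul_act, Y.one_act]
  have hr : Function.RightInverse (X.sigmaInv Y) (X.sigma Y) := fun p => by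
    simp [XGSet.sigma, XGSet.sigmaInv, ← Y.mul_act, Y.one_act]
  refine ⟨⟨⟨hl.injective, hr.surjective⟩, hl, hr⟩, ⟨fun g x y => ?_, fun x y => ?_⟩, ?_⟩
  · simp [XGSet.sigma, X.val_act, ← Y.mul_act]
  · simp [Y.val_act]
  · funext p
    simp [XGSet.ybLHS, XGSet.ybRHS, XGSet.sigma, Y.val_act, ← Z.mul_act]
end

section
/- Let G be a group and let 𝒟 = {f : {0,1}* → G | f(w) = f(w0)·f(w1)⁻¹ for all words w}. Then: (i) for g ∈ G and f ∈ 𝒟, the function g•f defined by (g•f)(w) = g·f(w)·g⁻¹ belongs to 𝒟, this defines a G-action on 𝒟, and with valuation |f| = f(ε) it satisfies |g•f| = g·|f|·g⁻¹, so 𝒟 is a crossed G-set; (ii) the map φ : 𝒟 × 𝒟 → 𝒟 defined by φ(f₀,f₁)(ε) = f₀(ε)·f₁(ε)⁻¹, φ(f₀,f₁)(0w) = f₀(w), φ(f₀,f₁)(1w) = f₁(w) is well defined (φ(f₀,f₁) ∈ 𝒟) and bijective, with inverse f ↦ (λw.f(0w), λw.f(1w)); (iii) φ is G-equivariant: g•φ(f₀,f₁)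 = φ(g•f₀, g•f₁), and |φ(f₀,f₁)| = |f₀|·|f₁|⁻¹. -/
namespace InfTree

variable {G : Type*} [Group G]

/-- Words over `{0,1}` are lists of booleans (`false` = `0`, `true` = `1`);
the empty list is `ε`, `w ++ [false]` is `w0`, `false :: w` is `0w`, etc.
`InD f` says that `f : {0,1}* → G` belongs to
`𝒟 = {f | f(w) = f(w0) · f(w1)⁻¹ for all w}`. -/
def InD (f : List Bool → G) : Prop :=
  ∀ w : List Bool, f w = f (w ++ [false]) * (f (w ++ [true]))⁻¹

/-- The `G`-action on functions `{0,1}* → G`: `(g • f)(w) = g · f(w) · g⁻¹`. -/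
def actD (g : G) (f : List Bool → G) : List Bool → G :=
  fun w => g * f w * g⁻¹

/-- The map `φ : 𝒟 × 𝒟 → 𝒟`:
`φ(f₀,f₁)(ε) = f₀(ε) · f₁(ε)⁻¹`, `φ(f₀,f₁)(0w) = f₀(w)`,
`φ(f₀,f₁)(1w) = f₁(w)`. -/
def phiD (f₀ f₁ : List Bool → G) : List Bool → G
  | [] => f₀ [] * (f₁ [])⁻¹
  | false :: w => f₀ w
  | true :: w => f₁ w

/-- The inverse of `φ`: `f ↦ (λw. f(0w), λw. f(1w))`. -/
def phiInv (f : List Bool → G) : (List Bool → G) × (List Bool → G) :=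
  (fun w => f (false :: w), fun w => f (true :: w))

theorem InD.actD {f : List Bool → G} (hf : InD f) (g : G) : InD (actD g f) := by
  intro w
  simp only [InfTree.actD, hf w]
  group

theorem actD_one (f : List Bool → G) : actD (1 : G) f = f := by
  funext w
  simp [actD]

theorem actD_mul (g h : G) (f : List Bool → G) : actD (g * h) f = actD g (actD h f) := by
  funext w
  simp [actD, mul_assoc]

theorem InD.phiD {f₀ f₁ : List Bool → G} (h₀ : InD f₀) (h₁ : InD f₁) : InD (phiD f₀ f₁)
  | [] => rfl
  | false :: w => h₀ w
  | true :: w => h₁ w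

theorem InD.phiInv_fst {f : List Bool → G} (hf : InD f) : InD (phiInv f).1 :=
  fun w => hf (false :: w)

theorem InD.phiInv_snd {f : List Bool → G} (hf : InD f) : InD (phiInv f).2 :=
  fun w => hf (true :: w)

theorem phiInv_phiD (f₀ f₁ : List Bool → G) : phiInv (phiD f₀ f₁) = (f₀, f₁) :=
  rfl

theorem InD.phiD_phiInv {f : List Bool → G} (hf : InD f) :
    InfTree.phiD (phiInv f).1 (phiInv f).2 = f := by
  funext w
  match w with
  | [] => exact (hf []).symm
  | false :: _ => rfl
  | true :: _ => rfl

theorem bijOn_phiD :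
    Set.BijOn (fun p : (List Bool → G) × (List Bool → G) => phiD p.1 p.2)
      ({f | InD f} ×ˢ {f | InD f}) {f | InD f} := by
  refine Set.InvOn.bijOn (f' := phiInv) ⟨fun p _ => phiInv_phiD p.1 p.2, fun f hf => ?_⟩
    (fun p hp => InD.phiD hp.1 hp.2) (fun f hf => ⟨InD.phiInv_fst hf, InD.phiInv_snd hf⟩)
  exact InD.phiD_phiInv hf

theorem actD_phiD (g : G) (f₀ f₁ : List Bool → G) :
    actD g (phiD f₀ f₁) = phiD (actD g f₀) (actD g f₁) := by
  funext w
  match w with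
  | [] =>
    simp only [actD, phiD]
    group
  | false :: _ => rfl
  | true :: _ => rfl

/-- Let `G` be a group and `𝒟 = {f : {0,1}* → G | f(w) = f(w0)·f(w1)⁻¹}`.
Then:
(i) `𝒟` is a crossed `G`-set: it is closed under the action
`(g•f)(w) = g·f(w)·g⁻¹`, this is a `G`-action, and the valuation
`|f| = f(ε)` satisfies `|g•f| = g·|f|·g⁻¹`;
(ii) `φ` is well defined (`φ(f₀,f₁) ∈ 𝒟` for `f₀, f₁ ∈ 𝒟`) and is a
bijection from `𝒟 × 𝒟` to `𝒟`, with inverse `f ↦ (λw.f(0w), λw.f(1w))`;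
(iii) `φ` is `G`-equivariant and `|φ(f₀,f₁)| = |f₀|·|f₁|⁻¹`. -/
theorem crossed_GSet_of_infinite_trees (G : Type*) [Group G] :
    -- (i) 𝒟 is a crossed G-set
    ((∀ (g : G) (f : List Bool → G), InD f → InD (actD g f)) ∧
      (∀ f : List Bool → G, actD (1 : G) f = f) ∧
      (∀ (g h : G) (f : List Bool → G), actD (g * h) f = actD g (actD h f)) ∧
      (∀ (g : G) (f : List Bool → G), (actD g f) [] = g * f [] * g⁻¹)) ∧
    -- (ii) φ is well defined and bijective, with inverse phiInv
    ((∀ f₀ f₁ : List Bool → G, InD f₀ → InD f₁ → InD (phiD f₀ f₁)) ∧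
      Set.BijOn (fun p : (List Bool → G) × (List Bool → G) => phiD p.1 p.2)
        ({f | InD f} ×ˢ {f | InD f}) {f | InD f} ∧
      (∀ f₀ f₁ : List Bool → G, InD f₀ → InD f₁ → phiInv (phiD f₀ f₁) = (f₀, f₁)) ∧
      (∀ f : List Bool → G, InD f → phiD (phiInv f).1 (phiInv f).2 = f)) ∧
    -- (iii) equivariance of φ and its valuation
    ((∀ (g : G) (f₀ f₁ : List Bool → G),
        actD g (phiD f₀ f₁) = phiD (actD g f₀) (actD g f₁)) ∧
      (∀ f₀ f₁ : List Bool → G, phiD f₀ f₁ [] = f₀ [] * (f₁ [])⁻¹)) := by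
  exact ⟨⟨fun g _ hf => hf.actD g, actD_one, actD_mul, fun _ _ => rfl⟩,
    ⟨fun _ _ => InD.phiD, bijOn_phiD, fun f₀ f₁ _ _ => phiInv_phiD f₀ f₁,
      fun _ => InD.phiD_phiInv⟩,
    ⟨actD_phiD, fun _ _ => rfl⟩⟩

end InfTree
end
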